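/- Let (U_k)_{k ∈ K} be a net of ultrafilters in S and let U be an ultrafilter in S. Then (U_k) converges to U in the subspace topology induced by the patch topology on the set of ultrafilters if and only if for each u ∈ U there exists k_u ∈ K such that u ∈ U_k for all k ⪰ k_u. -/

import Mathlib

/-- An inverse semigroup with zero: every element `a` has a unique `a⁻¹` with
`a * a⁻¹ * a = a` and `a⁻¹ * a * a⁻¹ = a⁻¹`, and `0` is absorbing. -/
class InvSemigroupWithZero (S : Type*) extends Semigroup S, Zero S, Inv S where
  mul_inv_mul : ∀ a : S, a * a⁻¹ * a = a
  inv_mul_inv : ∀ a : S, a⁻¹ * a * a⁻¹ = a⁻¹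
  inv_unique : ∀ a b : S, a * b * a = a → b * a * b = b → b = a⁻¹
  zero_mul : ∀ a : S, 0 * a = 0
  mul_zero : ∀ a : S, a * 0 = 0

namespace InvSemigroupWithZero

variable {S : Type*} [InvSemigroupWithZero S]

/-- The natural partial order on `S`: `a ≤ b` iff `a = a * a⁻¹ * b`. -/
def sle (a b : S) : Prop := a = a * a⁻¹ * b

/-- `↓s`, the down-set of `s` w.r.t. the natural partial order. -/
def dwn (s : S) : Set S := {t : S | sle t s}

/-- `↑A`, the up-set generated by `A` w.r.t. the natural partial order. -/
def up (A : Set S) : Set S := {b : S | ∃ a ∈ A, sle a b}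

/-- A filter in `S`: a nonempty down-directed up-set. -/
def IsFilt (F : Set S) : Prop :=
  F.Nonempty ∧ up F = F ∧ ∀ a ∈ F, ∀ b ∈ F, ∃ c ∈ F, sle c a ∧ sle c b

/-- A proper filter: a filter not containing `0`. -/
def IsPFilt (F : Set S) : Prop := IsFilt F ∧ (0 : S) ∉ F

/-- An ultrafilter: a proper filter maximal among proper filters. -/
def IsUltra (U : Set S) : Prop :=
  IsPFilt U ∧ ∀ G : Set S, IsPFilt G → U ⊆ G → U = G

/-- The set `E` of idempotents of `S`. -/
def E (S : Type*) [InvSemigroupWithZero S] : Set S := {e : S | e * e = e}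

/-- `F⁻¹ = {a⁻¹ : a ∈ F}`. -/
def finv (F : Set S) : Set S := (fun a : S => a⁻¹) '' F

/-- `F · G = ↑{fg : f ∈ F, g ∈ G}`. -/
def fmul (F G : Set S) : Set S := up (Set.image2 (· * ·) F G)

/-- The source `d(F) := F⁻¹ · F`. -/
def src (F : Set S) : Set S := fmul (finv F) F

/-- The range `r(F) := F · F⁻¹`. -/
def rng (F : Set S) : Set S := fmul F (finv F)

/-- The natural partial order on the idempotents: `e ≤ f` iff `e = e * f`. -/
def ele (e f : S) : Prop := e = e * f

/-- The down-set of an idempotent `e` inside `E`. -/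
def edwn (e : S) : Set S := {f : S | f ∈ E S ∧ ele f e}

/-- The up-set generated by `A` inside `E`. -/
def eup (A : Set S) : Set S := {f : S | f ∈ E S ∧ ∃ a ∈ A, ele a f}

/-- An `E`-filter: a proper filter of the inverse semigroup `E` of idempotents. -/
def IsEFilt (ξ : Set S) : Prop :=
  ξ ⊆ E S ∧ ξ.Nonempty ∧ eup ξ = ξ ∧
    (∀ a ∈ ξ, ∀ b ∈ ξ, ∃ c ∈ ξ, ele c a ∧ ele c b) ∧ (0 : S) ∉ ξ

/-- An `E`-ultrafilter: an `E`-filter maximal among `E`-filters. -/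
def IsEUltra (ξ : Set S) : Prop :=
  IsEFilt ξ ∧ ∀ η : Set S, IsEFilt η → ξ ⊆ η → ξ = η

/-- `β_s(ξ) = {f ∈ E : s·e·s⁻¹ ≤ f for some e ∈ ξ}`. -/
def beta (s : S) (ξ : Set S) : Set S :=
  {f : S | f ∈ E S ∧ ∃ e ∈ ξ, sle (s * e * s⁻¹) f}

/-- The set of proper filters in `S`. -/
abbrev PFilt (S : Type*) [InvSemigroupWithZero S] := {F : Set S // IsPFilt F}

/-- The patch topology on the set of proper filters, generated by the sets
`F(s;T) = {F : s ∈ F, F ∩ T = ∅}` for `s ∈ S` and finite `T ⊆ ↓s`. -/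
instance patchTopology : TopologicalSpace (PFilt S) :=
  TopologicalSpace.generateFrom
    {O : Set (PFilt S) | ∃ (s : S) (T : Set S), T.Finite ∧ T ⊆ dwn s ∧
      O = {F : PFilt S | s ∈ F.1 ∧ F.1 ∩ T = ∅}}

/-- The set of idempotent proper filters in `S`. -/
abbrev IPFilt (S : Type*) [InvSemigroupWithZero S] :=
  {F : Set S // IsPFilt F ∧ (F ∩ E S).Nonempty}

/-- The subspace topology induced by the patch topology on proper filters. -/
instance : TopologicalSpace (IPFilt S) :=
  TopologicalSpace.induced (fun F => (⟨F.1, F.2.1⟩ : PFilt S)) inferInstance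

/-- The set of `E`-filters. -/
abbrev EFilt (S : Type*) [InvSemigroupWithZero S] := {ξ : Set S // IsEFilt ξ}

/-- The patch topology on the set of `E`-filters, generated by the sets
`P(e;X) = {ξ : e ∈ ξ, ξ ∩ X = ∅}` for `e ∈ E` and finite `X ⊆ ↓e ∩ E`. -/
instance : TopologicalSpace (EFilt S) :=
  TopologicalSpace.generateFrom
    {O : Set (EFilt S) | ∃ (e : S) (X : Set S), e ∈ E S ∧ X.Finite ∧ X ⊆ edwn e ∧
      O = {ξ : EFilt S | e ∈ ξ.1 ∧ ξ.1 ∩ X = ∅}}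

/-- The set of ultrafilters in `S`. -/
abbrev UFilt (S : Type*) [InvSemigroupWithZero S] := {U : Set S // IsUltra U}

/-- The subspace topology induced by the patch topology on proper filters. -/
instance : TopologicalSpace (UFilt S) :=
  TopologicalSpace.induced (fun U => (⟨U.1, U.2.1⟩ : PFilt S)) inferInstance

theorem mul_mem_E_of_mem {e f : S} (he : e ∈ E S) (hf : f ∈ E S) : e * f ∈ E S := by
  have he' : ∀ x : S, e * (e * x) = e * x := fun x => by rw [← mul_assoc, he]
  have hf' : ∀ x : S, f * (f * x) = f * x := fun x => by rw [← mul_assoc, hf]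
  have h₁ := mul_inv_mul (e * f)
  have h₂ := inv_mul_inv (e * f)
  have h₃ : f * (e * f)⁻¹ * e = (e * f)⁻¹ := by
    apply inv_unique
    · simpa only [mul_assoc, he', hf'] using h₁
    · have := congrArg (fun x => f * x * e) h₂
      simpa only [mul_assoc, he', hf'] using this
  have h₄ : (e * f)⁻¹ * (e * f)⁻¹ = (e * f)⁻¹ := by
    have := congrArg (fun x => f * x * e) h₂
    calc (e * f)⁻¹ * (e * f)⁻¹ = f * (e * f)⁻¹ * e * (f * (e * f)⁻¹ * e) := by rw [h₃]
      _ = f * ((e * f)⁻¹ * (e * f) * (e * f)⁻¹) * e := by simp only [mul_assoc]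
      _ = (e * f)⁻¹ := by rw [h₂, h₃]
  have h₅ : e * f = (e * f)⁻¹⁻¹ := inv_unique _ _ h₂ h₁
  have h₆ : (e * f)⁻¹ = (e * f)⁻¹⁻¹ := inv_unique _ _ (by rw [h₄, h₄]) (by rw [h₄, h₄])
  have h₇ : (e * f)⁻¹ = e * f := h₆.trans h₅.symm
  change e * f * (e * f) = e * f
  rwa [h₇] at h₄

/-- The idempotents of an inverse semigroup commute. -/
theorem mul_comm_of_mem_E {e f : S} (he : e ∈ E S) (hf : f ∈ E S) : e * f = f * e := by
  have he' : ∀ x : S, e * (e * x) = e * x := fun x => by rw [← mul_assoc, he]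
  have hf' : ∀ x : S, f * (f * x) = f * x := fun x => by rw [← mul_assoc, hf]
  have h₁ : e * f * (e * f) = e * f := mul_mem_E_of_mem he hf
  have h₂ : f * e * (f * e) = f * e := mul_mem_E_of_mem hf he
  have h₃ : e * f = (e * f)⁻¹ := inv_unique _ _ (by rw [h₁, h₁]) (by rw [h₁, h₁])
  have h₄ : f * e = (e * f)⁻¹ := by
    apply inv_unique
    · simpa only [mul_assoc, he', hf'] using h₁
    · simpa only [mul_assoc, he', hf'] using h₂
  exact h₃.trans h₄.symm

theorem mul_inv_mem_E (a : S) : a * a⁻¹ ∈ E S := by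
  change a * a⁻¹ * (a * a⁻¹) = a * a⁻¹
  rw [← mul_assoc, mul_inv_mul]

theorem sle_refl (a : S) : sle a a := (mul_inv_mul a).symm

theorem mul_sle {e : S} (he : e ∈ E S) (b : S) : sle (e * b) b := by
  have hc : e * (b * b⁻¹) = b * b⁻¹ * e := mul_comm_of_mem_E he (mul_inv_mem_E b)
  have hee : e * e = e := he
  have h₁ : e * b * (b⁻¹ * e) = b * b⁻¹ * e := by
    calc e * b * (b⁻¹ * e) = e * (b * b⁻¹) * e := by simp only [mul_assoc]
      _ = b * b⁻¹ * e := by rw [hc, mul_assoc, hee]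
  have h₂ : b * b⁻¹ * e * b = e * b := by
    rw [← hc, mul_assoc, mul_inv_mul]
  have hinv : b⁻¹ * e = (e * b)⁻¹ := by
    apply inv_unique
    · rw [h₁, ← mul_assoc, mul_assoc _ e e, hee, h₂]
    · calc b⁻¹ * e * (e * b) * (b⁻¹ * e) = b⁻¹ * (e * e) * (b * b⁻¹ * e) := by
            simp only [mul_assoc]
        _ = b⁻¹ * (e * (b * b⁻¹)) * e := by rw [hee]; simp only [mul_assoc]
        _ = b⁻¹ * b * b⁻¹ * (e * e) := by rw [hc]; simp only [mul_assoc]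
        _ = b⁻¹ * e := by rw [inv_mul_inv, hee]
  change e * b = e * b * (e * b)⁻¹ * b
  rw [← hinv, h₁, h₂]

theorem sle_iff_exists_mul {a b : S} : sle a b ↔ ∃ e ∈ E S, a = e * b :=
  ⟨fun h => ⟨_, mul_inv_mem_E a, h⟩, by rintro ⟨e, he, rfl⟩; exact mul_sle he b⟩

theorem sle_trans {a b c : S} (hab : sle a b) (hbc : sle b c) : sle a c := by
  obtain ⟨e, he, rfl⟩ := sle_iff_exists_mul.1 hab
  obtain ⟨f, hf, rfl⟩ := sle_iff_exists_mul.1 hbc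
  rw [← mul_assoc]
  exact mul_sle (mul_mem_E_of_mem he hf) c

theorem mul_sle_mul_left {e a b : S} (he : e ∈ E S) (h : sle a b) : sle (e * a) (e * b) := by
  obtain ⟨f, hf, rfl⟩ := sle_iff_exists_mul.1 h
  rw [← mul_assoc, mul_comm_of_mem_E he hf, mul_assoc]
  exact mul_sle hf _

theorem eq_zero_of_sle_zero {a : S} (h : sle a 0) : a = 0 :=
  Eq.trans h (InvSemigroupWithZero.mul_zero _)

theorem sle_mul_inv_mul {c t x : S} (ht : sle c t) (hx : sle c x) : sle c (t * t⁻¹ * x) := by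
  have hc : t * t⁻¹ * c = c := by
    obtain ⟨e, he, rfl⟩ := sle_iff_exists_mul.1 ht
    rw [← mul_assoc, mul_comm_of_mem_E (mul_inv_mem_E t) he, mul_assoc, mul_inv_mul]
  rw [← hc]
  exact mul_sle_mul_left (mul_inv_mem_E t) hx

theorem IsFilt.mem_of_sle {F : Set S} (hF : IsFilt F) {a b : S} (ha : a ∈ F) (h : sle a b) :
    b ∈ F :=
  hF.2.1 ▸ (⟨a, ha, h⟩ : b ∈ up F)

theorem IsFilt.up_image_mul {F : Set S} (hF : IsFilt F) {e : S} (he : e ∈ E S) :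
    IsFilt (up ((e * ·) '' F)) := by
  refine ⟨?_, ?_, ?_⟩
  · obtain ⟨x, hx⟩ := hF.1
    exact ⟨e * x, e * x, ⟨x, hx, rfl⟩, sle_refl _⟩
  · ext b
    exact ⟨fun ⟨_, ⟨a, ha, hac⟩, hcb⟩ => ⟨a, ha, sle_trans hac hcb⟩,
      fun hb => ⟨b, hb, sle_refl b⟩⟩
  · rintro a ⟨_, ⟨x, hx, rfl⟩, hxa⟩ b ⟨_, ⟨y, hy, rfl⟩, hyb⟩
    obtain ⟨z, hz, hzx, hzy⟩ := hF.2.2 x hx y hy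
    exact ⟨e * z, ⟨e * z, ⟨z, hz, rfl⟩, sle_refl _⟩,
      sle_trans (mul_sle_mul_left he hzx) hxa, sle_trans (mul_sle_mul_left he hzy) hyb⟩

/-- If `t` lies below an element of an ultrafilter `U` but not in `U`, then some element of `U`
has only `0` as a common lower bound with `t`. -/
theorem IsUltra.exists_mul_eq_zero {U : Set S} (hU : IsUltra U) {s t : S} (hs : s ∈ U)
    (hts : sle t s) (ht : t ∉ U) : ∃ x ∈ U, t * t⁻¹ * x = 0 := by
  by_contra! h
  have hE := mul_inv_mem_E t
  have hG : IsPFilt (up ((t * t⁻¹ * ·) '' U)) := by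
    refine ⟨hU.1.1.up_image_mul hE, ?_⟩
    rintro ⟨_, ⟨x, hx, rfl⟩, hx0⟩
    exact h x hx (eq_zero_of_sle_zero hx0)
  have hUG := hU.2 _ hG fun x hx => ⟨_, ⟨x, hx, rfl⟩, mul_sle hE x⟩
  rw [hUG] at ht
  exact ht ⟨t, ⟨s, hs, Eq.symm hts⟩, sle_refl t⟩

theorem IsPFilt.notMem_of_mul_eq_zero {F : Set S} (hF : IsPFilt F) {t x : S} (hx : x ∈ F)
    (h : t * t⁻¹ * x = 0) : t ∉ F := by
  intro ht
  obtain ⟨c, hc, hct, hcx⟩ := hF.1.2.2 t ht x hx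
  have hc0 := sle_mul_inv_mul hct hcx
  rw [h] at hc0
  exact hF.2 (eq_zero_of_sle_zero hc0 ▸ hc)

end InvSemigroupWithZero

open InvSemigroupWithZero

/-- A net `(U_k)` of ultrafilters converges to an ultrafilter `U` in the
subspace patch topology iff for each `u ∈ U` there is `k_u` with `u ∈ U_k` for all
`k ⪰ k_u`. -/
theorem stmt_19 {S : Type*} [InvSemigroupWithZero S]
    {K : Type*} [Preorder K] [IsDirected K (· ≤ ·)] [Nonempty K]
    (u : K → UFilt S) (U : UFilt S) :
    Filter.Tendsto u Filter.atTop (nhds U) ↔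
      ∀ x ∈ U.1, ∃ k₀ : K, ∀ k, k₀ ≤ k → x ∈ (u k).1 := by
  have hind : Topology.IsInducing (fun V : UFilt S => (⟨V.1, V.2.1⟩ : PFilt S)) := ⟨rfl⟩
  rw [hind.tendsto_nhds_iff, TopologicalSpace.tendsto_nhds_generateFrom_iff]
  constructor
  · intro h x hx
    have := h _ ⟨x, ∅, Set.finite_empty, Set.empty_subset _, rfl⟩ ⟨hx, Set.inter_empty _⟩
    obtain ⟨k₀, hk₀⟩ := Filter.mem_atTop_sets.1 this
    exact ⟨k₀, fun k hk => (hk₀ k hk).1⟩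
  · rintro h _ ⟨s, T, hT, hTs, rfl⟩ ⟨hs, hUT⟩
    have hev : ∀ x ∈ U.1, ∀ᶠ k in Filter.atTop, x ∈ (u k).1 := fun x hx =>
      Filter.eventually_atTop.2 (h x hx)
    have hT' : ∀ᶠ k in Filter.atTop, ∀ t ∈ T, t ∉ (u k).1 := by
      rw [Filter.eventually_all_finite hT]
      intro t ht
      have htU : t ∉ U.1 := fun htU => Set.eq_empty_iff_forall_notMem.1 hUT t ⟨htU, ht⟩
      obtain ⟨x, hx, hx0⟩ := U.2.exists_mul_eq_zero hs (hTs ht) htU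
      filter_upwards [hev x hx] with k hk
      exact (u k).2.1.notMem_of_mul_eq_zero hk hx0
    filter_upwards [hev s hs, hT'] with k hks hkT
    exact ⟨hks, Set.eq_empty_iff_forall_notMem.2 fun t ht => hkT t ht.2 ht.1⟩
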